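/- arXiv:2206.02565 — 7 statements merged into one kernel-verified Lean document; each statement's English description precedes it below -/
import Mathlib

section
/- Let X be a set, L a set of real-valued functions on X and f : X → ℝ ∪ {+∞} any function. Then the (X×ℝ, L×{−1})-convex hull of epi f, namely the set {(y,c) ∈ X×ℝ : l(y) − c ≤ sup_{(z,d)∈epi f} (l(z) − d) for all l ∈ L} (which is the intersection of all sets of the form {(y,c) : l(y) − c ≤ g(l) for all l ∈ L}, g : L → ℝ ∪ {±∞}, containing epi f), equals the epigraph of the H_L-convex hull of f, where co_{H_L} f(x) = sup{ l(x) − c : l ∈ L, c ∈ ℝ, l(y) − c ≤ f(y) for all y ∈ X } (value −∞ if no such pair (l,c) exists). -/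
/-- The supremum of `l - d` over the epigraph of `f` is at most `c` iff `l - c` minorizes `f`. -/
theorem iSup_epigraph_le_coe_iff {X : Type*} (l : X → ℝ) (f : X → EReal) (c : ℝ) :
    (⨆ q ∈ {q : X × ℝ | f q.1 ≤ (q.2 : EReal)}, ((l q.1 - q.2 : ℝ) : EReal)) ≤ (c : EReal) ↔
      ∀ y, ((l y - c : ℝ) : EReal) ≤ f y := by
  simp only [iSup_le_iff, Set.mem_ofPred_eq, Prod.forall, EReal.coe_le_coe_iff]
  constructor
  · intro h y
    refine EReal.le_of_forall_lt_iff_le.mp fun z hz => ?_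
    have := h y z hz.le
    exact EReal.coe_le_coe_iff.mpr (by linarith)
  · intro h y d hd
    have := EReal.coe_le_coe_iff.mp ((h y).trans hd)
    linarith

/-- The `(X×ℝ, L×{-1})`-convex hull of the epigraph of `f` equals the epigraph of the
`H_L`-convex hull of `f`. -/
theorem statement2 {X : Type*} (L : Set (X → ℝ)) (f : X → EReal) (hbot : ∀ x, f x ≠ ⊥) :
    {p : X × ℝ | ∀ l ∈ L,
        ((l p.1 - p.2 : ℝ) : EReal) ≤
          ⨆ q ∈ {q : X × ℝ | f q.1 ≤ (q.2 : EReal)}, ((l q.1 - q.2 : ℝ) : EReal)} =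
      {p : X × ℝ |
        (⨆ l ∈ L, ⨆ c : ℝ, ⨆ _ : ∀ y, ((l y - c : ℝ) : EReal) ≤ f y, ((l p.1 - c : ℝ) : EReal))
          ≤ (p.2 : EReal)} := by
  ext p
  simp only [Set.mem_ofPred_eq, iSup_le_iff, EReal.coe_le_coe_iff]
  constructor
  · intro h l hl c hc
    have := EReal.coe_le_coe_iff.mp ((h l hl).trans ((iSup_epigraph_le_coe_iff l f c).mpr hc))
    linarith
  · intro h l hl
    refine EReal.le_of_forall_lt_iff_le.mp fun c hc => ?_
    have := h l hl c ((iSup_epigraph_le_coe_iff l f c).mp hc.le)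
    exact EReal.coe_le_coe_iff.mpr (by linarith)
end

section
/- Let X be a set, L a set of real-valued functions on X, f : X → ℝ ∪ {+∞} an L-convex function, and x ∈ X with f(x) ∈ ℝ. Put L_x = {l − l(x) : l ∈ L}. Then ∂_{L_x} f(x) is an (L_x, X)-convex set, i.e. ∂_{L_x} f(x) = { u ∈ L_x : u(y) ≤ sup_{l ∈ ∂_{L_x} f(x)} l(y) for all y ∈ X } (the supremum over the empty set being −∞). -/
/-- For an `L`-convex function `f` with `f(x)` finite, `∂_{L_x} f(x)` is an
`(L_x, X)`-convex set. -/
theorem statement6 {X : Type*} (L : Set (X → ℝ)) (f : X → EReal)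
    (hconv : ∃ U ⊆ L, ∀ x, f x = ⨆ u ∈ U, (u x : EReal))
    (hbot : ∀ y, f y ≠ ⊥)
    (x : X) (fx : ℝ) (hfx : f x = (fx : EReal)) :
    let Lx : Set (X → ℝ) := {g | ∃ l ∈ L, g = fun y => l y - l x}
    let D : Set (X → ℝ) := {l ∈ Lx | ∀ y, f y ≥ f x + ((l y - l x : ℝ) : EReal)}
    D = {u ∈ Lx | ∀ y, (u y : EReal) ≤ ⨆ l ∈ D, (l y : EReal)} := by
  intro Lx D
  ext u
  constructor
  · intro hu
    exact ⟨hu.1, fun y => le_iSup₂ (f := fun (l : X → ℝ) (_ : l ∈ D) => (l y : EReal)) u hu⟩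
  · rintro ⟨hu, hle⟩
    have vanish : ∀ l ∈ Lx, l x = 0 := by
      rintro _ ⟨l, -, rfl⟩
      exact sub_self _
    refine ⟨hu, fun y => ?_⟩
    rw [vanish u hu, sub_zero, hfx, ge_iff_le, add_comm,
      ← EReal.le_sub_iff_add_le (by simp) (by simp)]
    refine (hle y).trans (iSup₂_le fun l hl => ?_)
    have h := hl.2 y
    rwa [vanish l hl.1, sub_zero, hfx, ge_iff_le, add_comm,
      ← EReal.le_sub_iff_add_le (by simp) (by simp)] at h
end

section
/- Let X and Y be sets, L a set of real-valued functions on X, f : X → ℝ ∪ {+∞} an (L,X)-convex function, and u : Y → X a map. Put L∘u = {l∘u : l ∈ L}. Then for every x ∈ Y, { v∘u : v ∈ ∂_L f(u(x)) } ⊆ ∂_{L∘u} (f∘u)(x). If moreover every y ∈ X with f(y) < +∞ lies in the image of u, then equality holds: { v∘u : v ∈ ∂_L f(u(x)) } = ∂_{L∘u} (f∘u)(x). -/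
/-- Composition rule: `(∂_L f(u(x))) ∘ u ⊆ ∂_{L∘u}(f∘u)(x)`, with equality when every
point of the domain of `f` lies in the image of `u`. -/
theorem statement8 {X Y : Type*} (L : Set (X → ℝ)) (f : X → EReal)
    (hconv : ∃ U ⊆ L, ∀ x, f x = ⨆ l ∈ U, (l x : EReal))
    (u : Y → X) (x : Y) :
    let sdX : Set (X → ℝ) := {l ∈ L | ∀ y, f y ≥ f (u x) + ((l y - l (u x) : ℝ) : EReal)}
    let Lu : Set (Y → ℝ) := {g | ∃ l ∈ L, g = l ∘ u}
    let sdY : Set (Y → ℝ) := {w ∈ Lu | ∀ z, f (u z) ≥ f (u x) + ((w z - w x : ℝ) : EReal)}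
    ({w | ∃ v ∈ sdX, w = v ∘ u} ⊆ sdY) ∧
      ((∀ y : X, f y ≠ ⊤ → ∃ z : Y, u z = y) → {w | ∃ v ∈ sdX, w = v ∘ u} = sdY) := by
  intro sdX Lu sdY
  have hsub : {w | ∃ v ∈ sdX, w = v ∘ u} ⊆ sdY := by
    rintro _ ⟨v, ⟨hvL, hv⟩, rfl⟩
    exact ⟨⟨v, hvL, rfl⟩, fun z => hv (u z)⟩
  refine ⟨hsub, fun hdom => hsub.antisymm ?_⟩
  rintro _ ⟨⟨l, hlL, rfl⟩, hl⟩
  refine ⟨l, ⟨hlL, fun y => ?_⟩, rfl⟩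
  by_cases hy : f y = ⊤
  · rw [hy]
    exact le_top
  · obtain ⟨z, rfl⟩ := hdom y hy
    exact hl z
end

section
/- Let X be a set and L₁, L₂ two families of real-valued functions on X. Let f₁ : X → ℝ ∪ {+∞} be proper and L₁-convex and f₂ : X → ℝ ∪ {+∞} be proper and L₂-convex. Then supp(L₁+L₂, f₁+f₂) = co_{L₁+L₂}( supp(L₁,f₁) + supp(L₂,f₂) ), where the right-hand side is the (L₁+L₂)-convex hull of the Minkowski sum of the two support sets, i.e. supp(L₁+L₂, sup{ u₁+u₂ : u₁ ∈ supp(L₁,f₁), u₂ ∈ supp(L₂,f₂) }). -/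
/-- The sum of two `EReal`-valued suprema of real-valued functions is at most the supremum of the
pairwise sums. -/
theorem iSup_coe_add_iSup_coe_le {X : Type*} {U V : Set (X → ℝ)} {y : X} {c : EReal}
    (h : ∀ u ∈ U, ∀ v ∈ V, ((u y + v y : ℝ) : EReal) ≤ c) :
    (⨆ u ∈ U, (u y : EReal)) + (⨆ v ∈ V, (v y : EReal)) ≤ c := by
  refine EReal.add_le_of_forall_lt fun a ha b hb => ?_
  obtain ⟨u, hu, hau⟩ := lt_biSup_iff.1 ha
  obtain ⟨v, hv, hbv⟩ := lt_biSup_iff.1 hb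
  calc a + b ≤ (u y : EReal) + (v y : EReal) := add_le_add hau.le hbv.le
    _ = ((u y + v y : ℝ) : EReal) := (EReal.coe_add _ _).symm
    _ ≤ c := h u hu v hv


/-- `supp(L₁+L₂, f₁+f₂)` equals the `(L₁+L₂)`-convex hull of
`supp(L₁,f₁) + supp(L₂,f₂)`. -/
theorem statement10 {X : Type*} (L₁ L₂ : Set (X → ℝ))
    (f₁ f₂ : X → EReal) (h₁bot : ∀ x, f₁ x ≠ ⊥) (h₂bot : ∀ x, f₂ x ≠ ⊥)
    (h₁p : ∃ x, f₁ x ≠ ⊤) (h₂p : ∃ x, f₂ x ≠ ⊤)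
    (h₁ : ∃ U ⊆ L₁, ∀ x, f₁ x = ⨆ u ∈ U, (u x : EReal))
    (h₂ : ∃ U ⊆ L₂, ∀ x, f₂ x = ⨆ u ∈ U, (u x : EReal)) :
    let Lsum : Set (X → ℝ) := {g | ∃ l₁ ∈ L₁, ∃ l₂ ∈ L₂, g = fun y => l₁ y + l₂ y}
    let S₁ : Set (X → ℝ) := {u ∈ L₁ | ∀ y, (u y : EReal) ≤ f₁ y}
    let S₂ : Set (X → ℝ) := {u ∈ L₂ | ∀ y, (u y : EReal) ≤ f₂ y}
    let Ssum : Set (X → ℝ) := {g | ∃ u₁ ∈ S₁, ∃ u₂ ∈ S₂, g = fun y => u₁ y + u₂ y}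
    {u ∈ Lsum | ∀ y, (u y : EReal) ≤ f₁ y + f₂ y} =
      {u ∈ Lsum | ∀ y, (u y : EReal) ≤ ⨆ g ∈ Ssum, (g y : EReal)} := by
  intro Lsum S₁ S₂ Ssum
  obtain ⟨U, hU, hf₁⟩ := h₁
  obtain ⟨V, hV, hf₂⟩ := h₂
  have key : ∀ y, f₁ y + f₂ y = ⨆ g ∈ Ssum, (g y : EReal) := by
    intro y
    apply le_antisymm
    · rw [hf₁, hf₂]
      refine iSup_coe_add_iSup_coe_le fun u hu v hv => ?_
      have hu' : u ∈ S₁ :=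
        ⟨hU hu, fun z => hf₁ z ▸ le_biSup (fun w : X → ℝ => (w z : EReal)) hu⟩
      have hv' : v ∈ S₂ :=
        ⟨hV hv, fun z => hf₂ z ▸ le_biSup (fun w : X → ℝ => (w z : EReal)) hv⟩
      have huv : (fun z => u z + v z) ∈ Ssum := ⟨u, hu', v, hv', rfl⟩
      exact le_biSup (fun w : X → ℝ => (w y : EReal)) huv
    · refine iSup₂_le ?_
      rintro _ ⟨u, hu, v, hv, rfl⟩
      rw [EReal.coe_add]
      exact add_le_add (hu.2 y) (hv.2 y)
  simp only [key]
end

section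
/- Let X be a set, L₁, L₂ families of real-valued functions on X, f₁ : X → ℝ ∪ {+∞} proper and L₁-convex, and f₂ : X → ℝ ∪ {+∞} proper and L₂-convex. Then for every l ∈ L₁+L₂, (f₁+f₂)*(l) = co(f₁* ⊕ f₂*)(l), where (f₁+f₂)*(l) = sup_{x∈X} (l(x) − f₁(x) − f₂(x)), (f₁* ⊕ f₂*)(l) = inf{ f₁*(l₁) + f₂*(l₂) : l₁ ∈ L₁, l₂ ∈ L₂, l₁+l₂ = l }, and for g : L₁+L₂ → ℝ ∪ {±∞} the hull is co g(l) = sup{ l(x) − c : x ∈ X, c ∈ ℝ, and l'(x) − c ≤ g(l') for all l' ∈ L₁+L₂ } (the hull of g with respect to the elementary functions l ↦ l(x) − c on L₁+L₂). -/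
/-- A function lying below `f` has nonpositive conjugate at `f`. -/
lemma iSup_coe_sub_nonpos {X : Type*} {f : X → EReal} {u : X → ℝ}
    (hu : ∀ x, (u x : EReal) ≤ f x) : (⨆ x, ((u x : EReal) - f x)) ≤ 0 :=
  iSup_le fun x => by
    simpa using EReal.sub_le_of_le_add' (by simpa using hu x)

/-- If all sums of elements of two families of reals are at most `c`, then their suprema in
`EReal` are real and sum to at most `c`. -/
lemma exists_coe_eq_add_le_of_iSup {ι : Type*} {U V : Set ι} {u v : ι → ℝ} {a b : EReal} {c : ℝ}
    (ha : a = ⨆ i ∈ U, (u i : EReal)) (hb : b = ⨆ i ∈ V, (v i : EReal))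
    (ha' : a ≠ ⊥) (hb' : b ≠ ⊥) (h : ∀ i ∈ U, ∀ j ∈ V, u i + v j ≤ c) :
    ∃ r s : ℝ, a = r ∧ b = s ∧ r + s ≤ c := by
  have hU : ∃ i, i ∈ U := by
    by_contra! hU
    exact ha' (by simp [ha, hU])
  have hV : ∃ j, j ∈ V := by
    by_contra! hV
    exact hb' (by simp [hb, hV])
  obtain ⟨i₀, hi₀⟩ := hU
  obtain ⟨j₀, hj₀⟩ := hV
  have ha_le : ∀ j ∈ V, a ≤ ((c - v j : ℝ) : EReal) := fun j hj => by
    rw [ha]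
    exact iSup₂_le fun i hi => EReal.coe_le_coe_iff.2 (by linarith [h i hi j hj])
  have hb_le : ∀ r : ℝ, a = r → b ≤ ((c - r : ℝ) : EReal) := fun r hr => by
    rw [hb]
    refine iSup₂_le fun j hj => EReal.coe_le_coe_iff.2 ?_
    have := ha_le j hj
    rw [hr, EReal.coe_le_coe_iff] at this
    linarith
  have hat : a ≠ ⊤ := ((ha_le j₀ hj₀).trans_lt (EReal.coe_lt_top _)).ne
  lift a to ℝ using ⟨hat, ha'⟩ with r
  have hbr := hb_le r rfl
  have hbt : b ≠ ⊤ := (hbr.trans_lt (EReal.coe_lt_top _)).ne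
  lift b to ℝ using ⟨hbt, hb'⟩ with s
  rw [EReal.coe_le_coe_iff] at hbr
  exact ⟨r, s, rfl, rfl, by linarith⟩


/-- `(f₁+f₂)* = co_{L₁+L₂}(f₁* ⊕ f₂*)` on `L₁+L₂`. -/
theorem statement12 {X : Type*} (L₁ L₂ : Set (X → ℝ))
    (f₁ f₂ : X → EReal) (h₁bot : ∀ x, f₁ x ≠ ⊥) (h₂bot : ∀ x, f₂ x ≠ ⊥)
    (h₁p : ∃ x, f₁ x ≠ ⊤) (h₂p : ∃ x, f₂ x ≠ ⊤)
    (h₁ : ∃ U ⊆ L₁, ∀ x, f₁ x = ⨆ u ∈ U, (u x : EReal))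
    (h₂ : ∃ U ⊆ L₂, ∀ x, f₂ x = ⨆ u ∈ U, (u x : EReal)) :
    let conj₁ : (X → ℝ) → EReal := fun l => ⨆ x, ((l x : EReal) - f₁ x)
    let conj₂ : (X → ℝ) → EReal := fun l => ⨆ x, ((l x : EReal) - f₂ x)
    let Lsum : Set (X → ℝ) := {g | ∃ l₁ ∈ L₁, ∃ l₂ ∈ L₂, g = fun y => l₁ y + l₂ y}
    let infconv : (X → ℝ) → EReal := fun l =>
      ⨅ p ∈ {p : (X → ℝ) × (X → ℝ) | p.1 ∈ L₁ ∧ p.2 ∈ L₂ ∧ (fun y => p.1 y + p.2 y) = l},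
        (conj₁ p.1 + conj₂ p.2)
    ∀ l ∈ Lsum,
      (⨆ x, ((l x : EReal) - f₁ x - f₂ x)) =
        ⨆ x : X, ⨆ c : ℝ,
          ⨆ _ : ∀ l' ∈ Lsum, ((l' x - c : ℝ) : EReal) ≤ infconv l',
            ((l x - c : ℝ) : EReal) := by
  intro conj₁ conj₂ Lsum infconv l _
  apply le_antisymm
  · refine iSup_le fun x => ?_
    by_cases hx₁ : f₁ x = ⊤
    · simp [hx₁]
    by_cases hx₂ : f₂ x = ⊤
    · simp [hx₂]
    obtain ⟨a, ha⟩ : ∃ a : ℝ, f₁ x = a := ⟨_, (EReal.coe_toReal hx₁ (h₁bot x)).symm⟩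
    obtain ⟨b, hb⟩ : ∃ b : ℝ, f₂ x = b := ⟨_, (EReal.coe_toReal hx₂ (h₂bot x)).symm⟩
    have hc : ∀ l' ∈ Lsum, ((l' x - (a + b) : ℝ) : EReal) ≤ infconv l' := by
      rintro l' -
      refine le_iInf₂ ?_
      rintro ⟨l₁, l₂⟩ ⟨-, -, rfl⟩
      have hl₁ : ((l₁ x - a : ℝ) : EReal) ≤ conj₁ l₁ := by
        rw [EReal.coe_sub, ← ha]
        exact le_iSup (fun y => (l₁ y : EReal) - f₁ y) x
      have hl₂ : ((l₂ x - b : ℝ) : EReal) ≤ conj₂ l₂ := by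
        rw [EReal.coe_sub, ← hb]
        exact le_iSup (fun y => (l₂ y : EReal) - f₂ y) x
      calc ((l₁ x + l₂ x - (a + b) : ℝ) : EReal)
          = ((l₁ x - a : ℝ) : EReal) + ((l₂ x - b : ℝ) : EReal) := by
            rw [← EReal.coe_add, add_sub_add_comm]
        _ ≤ conj₁ l₁ + conj₂ l₂ := add_le_add hl₁ hl₂
    rw [ha, hb, ← EReal.coe_sub, ← EReal.coe_sub, sub_sub]
    exact le_iSup_of_le x (le_iSup_of_le (a + b) (le_iSup_of_le hc le_rfl))
  · refine iSup_le fun x => iSup_le fun c => iSup_le fun hc => ?_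
    obtain ⟨U₁, hU₁, hf₁⟩ := h₁
    obtain ⟨U₂, hU₂, hf₂⟩ := h₂
    have hle : ∀ u₁ ∈ U₁, ∀ u₂ ∈ U₂, u₁ x + u₂ x ≤ c := by
      intro u₁ hu₁ u₂ hu₂
      have hu₁f : ∀ y, (u₁ y : EReal) ≤ f₁ y := fun y => by
        rw [hf₁]
        exact le_iSup₂ (f := fun (u : X → ℝ) (_ : u ∈ U₁) => (u y : EReal)) u₁ hu₁
      have hu₂f : ∀ y, (u₂ y : EReal) ≤ f₂ y := fun y => by
        rw [hf₂]
        exact le_iSup₂ (f := fun (u : X → ℝ) (_ : u ∈ U₂) => (u y : EReal)) u₂ hu₂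
      have key : ((u₁ x + u₂ x - c : ℝ) : EReal) ≤ (0 : ℝ) := by
        calc ((u₁ x + u₂ x - c : ℝ) : EReal)
            ≤ infconv fun y => u₁ y + u₂ y := hc _ ⟨u₁, hU₁ hu₁, u₂, hU₂ hu₂, rfl⟩
          _ ≤ conj₁ u₁ + conj₂ u₂ := iInf₂_le (u₁, u₂) ⟨hU₁ hu₁, hU₂ hu₂, rfl⟩
          _ ≤ 0 + 0 := add_le_add (iSup_coe_sub_nonpos hu₁f) (iSup_coe_sub_nonpos hu₂f)
          _ = (0 : ℝ) := by simp
      linarith [EReal.coe_le_coe_iff.1 key]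
    obtain ⟨a, b, ha, hb, hab⟩ :=
      exists_coe_eq_add_le_of_iSup (hf₁ x) (hf₂ x) (h₁bot x) (h₂bot x) hle
    refine le_iSup_of_le x ?_
    rw [ha, hb, ← EReal.coe_sub, ← EReal.coe_sub, EReal.coe_le_coe_iff]
    linarith
end

section
/- Let X be a set, L₁, L₂ families of real-valued functions on X and L = L₁+L₂. Let C, D ⊆ X, and assume the indicator function δ_C is H_{L₁}-convex and δ_D is H_{L₂}-convex. Then epi_L(σ_{C∩D}) = co( epi_{L₁} σ_C + epi_{L₂} σ_D ), where σ_S(l) = sup_{x∈S} l(x), epi_{M} σ = {(l,c) ∈ M×ℝ : σ(l) ≤ c}, the sum is the Minkowski sum in (functions)×ℝ, and the hull of a set S ⊆ L×ℝ is co S = {(l,c) ∈ L×ℝ : l(x) − c ≤ sup_{(l',c')∈S} (l'(x) − c') for all x ∈ X}. -/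
open Classical

/-- If `δ_S` is `H_L`-convex, then the pairs in `epi_L σ_S` give minorants `l - c` of `δ_S` whose
values at any point come arbitrarily close to `δ_S`. -/
theorem exists_supportEpi_lt {X : Type*} {L : Set (X → ℝ)} {S : Set X}
    (hS : ∃ U ⊆ {g : X → ℝ | ∃ l ∈ L, ∃ c : ℝ, g = fun x => l x - c},
      ∀ x, (if x ∈ S then (0 : EReal) else ⊤) = ⨆ u ∈ U, (u x : EReal))
    (x : X) (M : ℝ) (hM : x ∈ S → M < 0) :
    ∃ l ∈ L, ∃ c : ℝ, (⨆ y ∈ S, (l y : EReal)) ≤ (c : EReal) ∧ M < l x - c := by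
  obtain ⟨U, hU, h⟩ := hS
  have hlt : (M : EReal) < ⨆ u ∈ U, (u x : EReal) := by
    rw [← h x]
    split_ifs with hx
    · exact_mod_cast hM hx
    · exact EReal.coe_lt_top M
  simp only [lt_iSup_iff] at hlt
  obtain ⟨u, hu, hMu⟩ := hlt
  obtain ⟨l, hl, c, rfl⟩ := hU hu
  refine ⟨l, hl, c, iSup₂_le fun y hy => ?_, by exact_mod_cast hMu⟩
  have hle : ((l y - c : ℝ) : EReal) ≤ 0 := by
    have := h y
    rw [if_pos hy] at this
    rw [this]
    exact le_iSup₂ (f := fun (u : X → ℝ) (_ : u ∈ U) => (u y : EReal)) _ hu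
  have : l y - c ≤ 0 := by exact_mod_cast hle
  exact_mod_cast sub_nonpos.mp this

/-- `epi_{L₁+L₂} σ_{C∩D} = co((epi_{L₁} σ_C) + (epi_{L₂} σ_D))`. -/
theorem statement14 {X : Type*} (L₁ L₂ : Set (X → ℝ)) (C D : Set X)
    (hC : ∃ U ⊆ {g : X → ℝ | ∃ l ∈ L₁, ∃ c : ℝ, g = fun x => l x - c},
      ∀ x, (if x ∈ C then (0 : EReal) else ⊤) = ⨆ u ∈ U, (u x : EReal))
    (hD : ∃ U ⊆ {g : X → ℝ | ∃ l ∈ L₂, ∃ c : ℝ, g = fun x => l x - c},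
      ∀ x, (if x ∈ D then (0 : EReal) else ⊤) = ⨆ u ∈ U, (u x : EReal)) :
    let Lsum : Set (X → ℝ) := {g | ∃ l₁ ∈ L₁, ∃ l₂ ∈ L₂, g = fun y => l₁ y + l₂ y}
    let σ : Set X → (X → ℝ) → EReal := fun S l => ⨆ x ∈ S, (l x : EReal)
    let epiSum : Set ((X → ℝ) × ℝ) :=
      {q | ∃ r ∈ {r : (X → ℝ) × ℝ | r.1 ∈ L₁ ∧ σ C r.1 ≤ (r.2 : EReal)},
           ∃ s ∈ {s : (X → ℝ) × ℝ | s.1 ∈ L₂ ∧ σ D s.1 ≤ (s.2 : EReal)},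
             q = (fun y => r.1 y + s.1 y, r.2 + s.2)}
    {q : (X → ℝ) × ℝ | q.1 ∈ Lsum ∧ σ (C ∩ D) q.1 ≤ (q.2 : EReal)} =
      {q : (X → ℝ) × ℝ | q.1 ∈ Lsum ∧
        ∀ x : X, ((q.1 x - q.2 : ℝ) : EReal) ≤ ⨆ p ∈ epiSum, ((p.1 x - p.2 : ℝ) : EReal)} := by
  intro Lsum σ epiSum
  have le_of_mem {S : Set X} {l : X → ℝ} {c : ℝ} (h : σ S l ≤ (c : EReal)) {x : X} (hx : x ∈ S) :
      l x ≤ c := by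
    exact_mod_cast (le_iSup₂ (f := fun y (_ : y ∈ S) => (l y : EReal)) x hx).trans h
  ext ⟨l, c⟩
  refine and_congr_right fun _ => ⟨fun h x => ?_, fun h => iSup₂_le fun x hx => ?_⟩
  · refine le_of_forall_lt_imp_le_of_dense fun m hm => ?_
    obtain ⟨M, hmM, hM⟩ := EReal.lt_iff_exists_real_btwn.mp hm
    have hM : M < l x - c := by exact_mod_cast hM
    have key : ∃ l₁ ∈ L₁, ∃ c₁ : ℝ, σ C l₁ ≤ (c₁ : EReal) ∧
        ∃ l₂ ∈ L₂, ∃ c₂ : ℝ, σ D l₂ ≤ (c₂ : EReal) ∧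
          M < (l₁ x - c₁) + (l₂ x - c₂) := by
      by_cases hxC : x ∈ C
      · by_cases hxD : x ∈ D
        · have hM0 : M < 0 := hM.trans_le (sub_nonpos.mpr (le_of_mem h ⟨hxC, hxD⟩))
          obtain ⟨l₁, hl₁, c₁, h₁, hlt₁⟩ := exists_supportEpi_lt hC x (M / 2)
            fun _ => by linarith
          obtain ⟨l₂, hl₂, c₂, h₂, hlt₂⟩ := exists_supportEpi_lt hD x (M / 2)
            fun _ => by linarith
          exact ⟨l₁, hl₁, c₁, h₁, l₂, hl₂, c₂, h₂, by linarith⟩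
        · obtain ⟨l₁, hl₁, c₁, h₁, -⟩ := exists_supportEpi_lt hC x (-1) fun _ => by norm_num
          obtain ⟨l₂, hl₂, c₂, h₂, hlt₂⟩ := exists_supportEpi_lt hD x (M - (l₁ x - c₁))
            fun hx => absurd hx hxD
          exact ⟨l₁, hl₁, c₁, h₁, l₂, hl₂, c₂, h₂, by linarith⟩
      · obtain ⟨l₂, hl₂, c₂, h₂, -⟩ := exists_supportEpi_lt hD x (-1) fun _ => by norm_num
        obtain ⟨l₁, hl₁, c₁, h₁, hlt₁⟩ := exists_supportEpi_lt hC x (M - (l₂ x - c₂))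
          fun hx => absurd hx hxC
        exact ⟨l₁, hl₁, c₁, h₁, l₂, hl₂, c₂, h₂, by linarith⟩
    obtain ⟨l₁, hl₁, c₁, h₁, l₂, hl₂, c₂, h₂, hlt⟩ := key
    have hmem : ((fun y => l₁ y + l₂ y, c₁ + c₂) : (X → ℝ) × ℝ) ∈ epiSum :=
      ⟨(l₁, c₁), ⟨hl₁, h₁⟩, (l₂, c₂), ⟨hl₂, h₂⟩, rfl⟩
    have hle : M ≤ l₁ x + l₂ x - (c₁ + c₂) := by linarith
    exact (hmM.le.trans (EReal.coe_le_coe_iff.mpr hle)).trans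
      (le_iSup₂ (f := fun (p : (X → ℝ) × ℝ) (_ : p ∈ epiSum) => ((p.1 x - p.2 : ℝ) : EReal))
        _ hmem)
  · have hle : ((l x - c : ℝ) : EReal) ≤ ((0 : ℝ) : EReal) := by
      refine (h x).trans (iSup₂_le ?_)
      rintro _ ⟨r, ⟨-, hr⟩, s, ⟨-, hs⟩, rfl⟩
      have h₁ := le_of_mem hr hx.1
      have h₂ := le_of_mem hs hx.2
      exact EReal.coe_le_coe_iff.mpr (by dsimp only; linarith)
    exact EReal.coe_le_coe_iff.mpr (sub_nonpos.mp (EReal.coe_le_coe_iff.mp hle))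
end

section
/- Let X be a real Banach space, L a set of real-valued functions on X, and f : X → ℝ ∪ {+∞} a proper, lower semicontinuous, L-convex function. Assume that for every y ∈ X and every v ∈ L, the tilted translate f̄(x) = f(x+y) − v(x+y) is proper, lower semicontinuous, and satisfies Assumption (A) with respect to the family L₀^{v,y} = { x ↦ u(x+y) − v(x+y) + v(y) − u(y) : u ∈ L }. Then the L-subdifferential ∂_L f is a maximal L-monotone operator: (i) for all x, y ∈ X, u ∈ ∂_L f(x) and v ∈ ∂_L f(y), one has u(x) − u(y) + v(y) − v(x) ≥ 0; and (ii) whenever (y,v) ∈ X × L satisfies u(x) − u(y) + v(y) − v(x) ≥ 0 for all x ∈ X and all u ∈ ∂_L f(x), it follows that v ∈ ∂_L f(y). -/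
/-- The `L`-subdifferential of `f` at `x`. -/
def subdiff {X : Type*} (L : Set (X → ℝ)) (f : X → EReal) (x : X) : Set (X → ℝ) :=
  {l ∈ L | ∀ y, f y ≥ f x + ((l y - l x : ℝ) : EReal)}

/-- The `M`-support set of `φ`. -/
def suppE {X : Type*} (M : Set (X → ℝ)) (φ : X → EReal) : Set (X → ℝ) :=
  {u ∈ M | ∀ y, (u y : EReal) ≤ φ y}

/-- The vertical closure `H_M = {m - c : m ∈ M, c ∈ ℝ}`. -/
def Hof {X : Type*} (M : Set (X → ℝ)) : Set (X → ℝ) :=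
  {g | ∃ m ∈ M, ∃ c : ℝ, g = fun x => m x - c}

/-- Minkowski sum of two sets of real-valued functions. -/
def msum {X : Type*} (M N : Set (X → ℝ)) : Set (X → ℝ) :=
  {g | ∃ m ∈ M, ∃ n ∈ N, g = fun x => m x + n x}

/-- The continuous linear functionals on `X`, regarded as real-valued functions. -/
def linFuns (X : Type*) [NormedAddCommGroup X] [NormedSpace ℝ X] : Set (X → ℝ) :=
  {g | ∃ p : X →L[ℝ] ℝ, g = fun x => p x}

/-- Assumption (A): for every `a > 0` and `x̄ ∈ X`,
`supp(H_L, f) + supp(H_𝓛, a‖·−x̄‖) = supp(H_{L+𝓛}, f + a‖·−x̄‖)` and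
`f + a‖·−x̄‖` is bounded below on `X`. -/
def AssumptionA {X : Type*} [NormedAddCommGroup X] [NormedSpace ℝ X]
    (L : Set (X → ℝ)) (f : X → EReal) : Prop :=
  ∀ a : ℝ, 0 < a → ∀ x₀ : X,
    (msum (suppE (Hof L) f)
        (suppE (Hof (linFuns X)) (fun x => ((a * ‖x - x₀‖ : ℝ) : EReal))) =
      suppE (Hof (msum L (linFuns X))) (fun x => f x + ((a * ‖x - x₀‖ : ℝ) : EReal))) ∧
    ∃ m : ℝ, ∀ x, (m : EReal) ≤ f x + ((a * ‖x - x₀‖ : ℝ) : EReal)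


open Filter Topology Set

/-- Ekeland's variational principle in Phelps' form: a closed subset of `X × ℝ` whose heights are
bounded below has, below each of its points, a minimal point for the order of slope `δ`. -/
theorem exists_minimal_of_isClosed_of_bddBelow {X : Type*} [MetricSpace X] [CompleteSpace X]
    {E : Set (X × ℝ)} (hE : IsClosed E) {N : ℝ} (hN : ∀ p ∈ E, N ≤ p.2) {δ : ℝ} (hδ : 0 < δ)
    {p₀ : X × ℝ} (hp₀ : p₀ ∈ E) :
    ∃ p ∈ E, p.2 + δ * dist p.1 p₀.1 ≤ p₀.2 ∧
      ∀ q ∈ E, q.2 + δ * dist q.1 p.1 ≤ p.2 → q = p := by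
  have step : ∀ p : E, ∃ p' : E, (p' : X × ℝ).2 + δ * dist (p' : X × ℝ).1 p.1.1 ≤ p.1.2 ∧
      ∀ q ∈ E, q.2 + δ * dist q.1 p.1.1 ≤ p.1.2 → 2 * (p' : X × ℝ).2 - p.1.2 ≤ q.2 := by
    intro p
    let S : Set ℝ := {t | ∃ q ∈ E, q.2 + δ * dist q.1 p.1.1 ≤ p.1.2 ∧ t = q.2}
    have hmem : p.1.2 ∈ S := ⟨p, p.2, by simp, rfl⟩
    have hS : BddBelow S := ⟨N, by rintro _ ⟨q, hq, -, rfl⟩; exact hN q hq⟩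
    have hle : sInf S ≤ p.1.2 := csInf_le hS hmem
    rcases hle.eq_or_lt with h | h
    · refine ⟨p, by simp, fun q hq hqp => ?_⟩
      have : sInf S ≤ q.2 := csInf_le hS ⟨q, hq, hqp, rfl⟩
      linarith
    · obtain ⟨_, ⟨q, hq, hqp, rfl⟩, hlt⟩ :=
        exists_lt_of_csInf_lt ⟨_, hmem⟩ (show sInf S < (p.1.2 + sInf S) / 2 by linarith)
      refine ⟨⟨q, hq⟩, hqp, fun q' hq' hqp' => ?_⟩
      have : sInf S ≤ q'.2 := csInf_le hS ⟨q', hq', hqp', rfl⟩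
      simp only
      linarith
  choose next hnext hinf using step
  let s : ℕ → E := fun n => next^[n] ⟨p₀, hp₀⟩
  have hs : ∀ n, s (n + 1) = next (s n) := fun n => Function.iterate_succ_apply' _ _ _
  have below : ∀ n k, (s (n + k)).1.2 + δ * dist (s (n + k)).1.1 (s n).1.1 ≤ (s n).1.2 := by
    intro n k
    induction k with
    | zero => simp
    | succ k ih =>
      have h := hnext (s (n + k))
      rw [← hs] at h
      have tri := mul_le_mul_of_nonneg_left
        (dist_triangle (s (n + k + 1)).1.1 (s (n + k)).1.1 (s n).1.1) hδ.le
      rw [← add_assoc]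
      linarith
  have hanti : Antitone fun n => (s n).1.2 := by
    refine antitone_nat_of_succ_le fun n => ?_
    have := below n 1
    have : 0 ≤ δ * dist (s (n + 1)).1.1 (s n).1.1 := by positivity
    linarith
  have hbdd : BddBelow (range fun n => (s n).1.2) :=
    ⟨N, by rintro _ ⟨n, rfl⟩; exact hN _ (s n).2⟩
  obtain ⟨t, ht⟩ : ∃ t, Tendsto (fun n => (s n).1.2) atTop (𝓝 t) :=
    ⟨_, tendsto_atTop_ciInf hanti hbdd⟩
  have htle : ∀ n, t ≤ (s n).1.2 := fun n => hanti.le_of_tendsto ht n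
  have hcau : CauchySeq fun n => (s n).1.1 := by
    refine cauchySeq_of_le_tendsto_0' (fun n => ((s n).1.2 - t) / δ) (fun n m hnm => ?_) ?_
    · obtain ⟨k, rfl⟩ := Nat.exists_eq_add_of_le hnm
      rw [le_div_iff₀ hδ, dist_comm]
      linarith [below n k, htle (n + k)]
    · simpa using (ht.sub_const t).div_const δ
  obtain ⟨x, hx⟩ := cauchySeq_tendsto_of_complete hcau
  have hlim : ∀ n, t + δ * dist x (s n).1.1 ≤ (s n).1.2 := by
    intro n
    refine le_of_tendsto (ht.add ((hx.dist tendsto_const_nhds).const_mul δ)) ?_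
    filter_upwards [eventually_ge_atTop n] with m hm
    obtain ⟨k, rfl⟩ := Nat.exists_eq_add_of_le hm
    exact below n k
  refine ⟨(x, t), hE.mem_of_tendsto (hx.prodMk_nhds ht) (Eventually.of_forall fun n => (s n).2),
    hlim 0, fun q hq hqp => ?_⟩
  simp only at hqp
  have hlow : ∀ n, 2 * (s (n + 1)).1.2 - (s n).1.2 ≤ q.2 := by
    intro n
    rw [hs]
    refine hinf (s n) q hq ?_
    have tri := mul_le_mul_of_nonneg_left (dist_triangle q.1 x (s n).1.1) hδ.le
    linarith [hlim n]
  have hge : t ≤ q.2 := by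
    have hconv := ((ht.comp (tendsto_add_atTop_nat 1)).const_mul 2).sub ht
    have := le_of_tendsto hconv (Eventually.of_forall hlow)
    linarith
  have hdist : dist q.1 x = 0 :=
    le_antisymm (nonpos_of_mul_nonpos_right (by linarith) hδ) dist_nonneg
  refine Prod.ext (dist_eq_zero.1 hdist) (le_antisymm ?_ hge)
  simpa [hdist] using hqp

theorem EReal.coe_le_add_coe_iff_forall {h b : ℝ} {G : EReal} :
    (h : EReal) ≤ G + (b : EReal) ↔ ∀ r : ℝ, G ≤ r → h ≤ r + b := by
  induction G with
  | bot =>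
    simp only [EReal.bot_add, bot_le, forall_const, le_bot_iff, EReal.coe_ne_bot, false_iff,
      not_forall]
    exact ⟨h - b - 1, by linarith⟩
  | top => simp
  | coe g =>
    norm_cast
    exact ⟨fun hg r hr => by linarith, fun H => H g le_rfl⟩

theorem EReal.coe_le_iff_forall {h : ℝ} {G : EReal} :
    (h : EReal) ≤ G ↔ ∀ r : ℝ, G ≤ r → h ≤ r := by
  simpa using EReal.coe_le_add_coe_iff_forall (h := h) (b := 0) (G := G)

section

variable {X : Type*} [NormedAddCommGroup X] [NormedSpace ℝ X]

theorem ContinuousLinearMap.le_mul_norm_of_add_le {q : X →L[ℝ] ℝ} {a d : ℝ}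
    (h : ∀ x, q x + d ≤ a * ‖x‖) (x : X) : q x ≤ a * ‖x‖ := by
  by_contra! hlt
  obtain ⟨n, hn⟩ := exists_nat_gt (-d / (q x - a * ‖x‖))
  rw [div_lt_iff₀ (by linarith)] at hn
  have := h ((n : ℝ) • x)
  rw [map_smul, norm_smul, smul_eq_mul, Real.norm_natCast] at this
  linarith

/-- Under Assumption (A), an affine minorant of `g + a‖·-x₀‖` splits into an affine minorant of `g`
with linear part in `M` and an affine minorant of `a‖·-x₀‖`. -/
theorem AssumptionA.exists_split {M : Set (X → ℝ)} {g : X → EReal} (hA : AssumptionA M g)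
    (hzero : (fun _ => 0) ∈ M) (hM : ∀ m ∈ M, m 0 = 0) {a : ℝ} (ha : 0 < a) (x₀ : X)
    (l : X →L[ℝ] ℝ) (c : ℝ) (h : ∀ x (r : ℝ), g x ≤ r → l x + c ≤ r + a * ‖x - x₀‖) :
    ∃ q : X →L[ℝ] ℝ, ∃ d : ℝ, (fun x => l x - q x) ∈ M ∧
      (∀ x (r : ℝ), g x ≤ r → l x - q x + (c - d) ≤ r) ∧ ∀ x, q x + d ≤ a * ‖x - x₀‖ := by
  have hmem : (fun x => l x + c) ∈
      suppE (Hof (msum M (linFuns X))) (fun x => g x + ((a * ‖x - x₀‖ : ℝ) : EReal)) :=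
    ⟨⟨fun x => l x, ⟨_, hzero, _, ⟨l, rfl⟩, by simp⟩, -c, by simp⟩,
      fun x => EReal.coe_le_add_coe_iff_forall.2 (h x)⟩
  rw [← (hA a ha x₀).1] at hmem
  obtain ⟨_, ⟨⟨m, hm, c₁, rfl⟩, hm'⟩, _, ⟨⟨_, ⟨q, rfl⟩, c₂, rfl⟩, hq⟩, heq⟩ := hmem
  have heq' : ∀ x, l x + c = m x - c₁ + (q x - c₂) := congrFun heq
  have hc : c = -c₁ - c₂ := by
    have := heq' 0
    simp only [map_zero, hM m hm] at this
    linarith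
  have hml : m = fun x => l x - q x := by
    funext x
    linarith [heq' x]
  refine ⟨q, -c₂, hml ▸ hm, fun x r hr => ?_, fun x => ?_⟩
  · have := EReal.coe_le_iff_forall.1 (hm' x) r hr
    linarith [heq' x]
  · have : q x - c₂ ≤ a * ‖x - x₀‖ := EReal.coe_le_coe_iff.1 (hq x)
    linarith

/-- If `0` does not minimize `g`, then some `M`-subgradient of `g` is negative at its base
point. -/
theorem AssumptionA.exists_subgradient_neg [CompleteSpace X] {M : Set (X → ℝ)} {g : X → EReal}
    (hA : AssumptionA M g) (hzero : (fun _ => 0) ∈ M) (hM : ∀ m ∈ M, m 0 = 0)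
    (hbot : ∀ x, g x ≠ ⊥) (hg : LowerSemicontinuous g) {x₁ : X} (hx₁ : g x₁ < g 0) :
    ∃ z, ∃ t : ℝ, g z = t ∧ ∃ m ∈ M, (∀ x (r : ℝ), g x ≤ r → t + (m x - m z) ≤ r) ∧ m z < 0 := by
  obtain ⟨t₂, h₁₂, h₂⟩ := EReal.lt_iff_exists_real_btwn.1 hx₁
  obtain ⟨t₁, ht₁⟩ : ∃ t₁ : ℝ, g x₁ = t₁ :=
    ⟨(g x₁).toReal, (EReal.coe_toReal hx₁.ne_top (hbot _)).symm⟩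
  rw [ht₁, EReal.coe_lt_coe_iff] at h₁₂
  obtain ⟨a, ha, hat⟩ := exists_pos_mul_lt (sub_pos.2 h₁₂) ‖x₁‖
  obtain ⟨ρ, hρ, hball⟩ := Metric.eventually_nhds_iff.1 (hg 0 _ h₂)
  let S : Set ℝ := {s | ∃ x, ∃ r : ℝ, g x ≤ r ∧ s = r + a * ‖x‖}
  have hS : BddBelow S := by
    obtain ⟨b, hb⟩ := (hA a ha 0).2
    refine ⟨b, ?_⟩
    rintro _ ⟨x, r, hr, rfl⟩
    simpa using EReal.coe_le_add_coe_iff_forall.1 (hb x) r hr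
  have hS₁ : t₁ + a * ‖x₁‖ ∈ S := ⟨x₁, t₁, ht₁.le, rfl⟩
  set N := sInf S
  have hN₂ : N < t₂ := (csInf_le hS hS₁).trans_lt (by linarith)
  have hN : ∀ x (r : ℝ), g x ≤ r → N ≤ r + a * ‖x‖ := fun x r hr => csInf_le hS ⟨x, r, hr, rfl⟩
  obtain ⟨ε, hε, hεlt⟩ := exists_between
    (show 0 < min (t₂ - N) (a * ρ / 8) from lt_min (by linarith) (by positivity))
  obtain ⟨hε₁, hε₂⟩ := lt_min_iff.1 hεlt
  obtain ⟨_, ⟨x, r, hxr, rfl⟩, hxN⟩ :=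
    exists_lt_of_csInf_lt ⟨_, hS₁⟩ (show sInf S < N + ε by linarith)
  have hρx : ρ ≤ ‖x‖ := by
    by_contra! hlt
    have h₂x : t₂ < r := by exact_mod_cast (hball (by simpa using hlt)).trans_le hxr
    have : 0 ≤ a * ‖x‖ := by positivity
    linarith
  obtain ⟨q, d, -, hqg, hqa⟩ := hA.exists_split hzero hM ha 0 0 N (by simpa using hN)
  simp only [sub_zero, zero_apply, zero_sub] at hqg hqa
  have hd : d ≤ 0 := by simpa using hqa 0
  have hq := ContinuousLinearMap.le_mul_norm_of_add_le hqa
  let E : Set (X × ℝ) := {p | g p.1 ≤ ((p.2 - q p.1 : ℝ) : EReal)}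
  have hE : IsClosed E := hg.isClosed_epigraph.preimage
    (f := fun p : X × ℝ => (p.1, ((p.2 - q p.1 : ℝ) : EReal)))
    (continuous_fst.prodMk (continuous_coe_real_ereal.comp (by fun_prop)))
  have hEN : ∀ p ∈ E, N - d ≤ p.2 := fun p hp => by linarith [hqg _ _ hp]
  have hmemE : ∀ w (s : ℝ), g w ≤ s → (w, s + q w) ∈ E := by
    intro w s hs
    change g w ≤ ((s + q w - q w : ℝ) : EReal)
    rwa [add_sub_cancel_right]
  obtain ⟨⟨z, t⟩, hzE, hzx, hmin⟩ :=
    exists_minimal_of_isClosed_of_bddBelow hE hEN (half_pos ha) (hmemE x r hxr)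
  simp only [dist_eq_norm] at hzx hmin
  have hgz : g z = ((t - q z : ℝ) : EReal) := by
    have hs := EReal.coe_toReal (ne_top_of_le_ne_top (EReal.coe_ne_top _) hzE) (hbot z)
    have hle : (g z).toReal ≤ t - q z := by
      rw [← EReal.coe_le_coe_iff, hs]
      exact hzE
    have := hmin (z, (g z).toReal + q z) (hmemE _ _ hs.ge) (by simp; linarith)
    rw [← hs, EReal.coe_eq_coe_iff]
    have := congrArg Prod.snd this
    simp only at this
    linarith
  have hslope : ∀ w (s : ℝ), g w ≤ s → (-q) w + t ≤ s + a / 2 * ‖w - z‖ := by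
    intro w s hs
    by_contra! hlt
    simp only [neg_apply] at hlt
    have := hmin (w, s + q w) (hmemE w s hs) (by simp only; linarith)
    simp only [Prod.mk.injEq] at this
    obtain ⟨rfl, h⟩ := this
    simp only [sub_self, norm_zero, mul_zero] at hlt
    linarith
  obtain ⟨q', d', hmem, hq'g, hq'a⟩ := hA.exists_split hzero hM (half_pos ha) z (-q) t hslope
  simp only [neg_apply] at hmem hq'g
  have hd'z : d' + q' z = 0 := by
    have h₁ := hq'g z _ hgz.le
    have h₂ := hq'a z
    simp only [sub_self, norm_zero, mul_zero] at h₂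
    linarith
  refine ⟨z, t - q z, hgz, _, hmem, fun w s hs => by linarith [hq'g w s hs], ?_⟩
  have hd'0 := hq'a 0
  simp only [map_zero, zero_sub, norm_neg, zero_add] at hd'0
  have hqxz := hq (x - z)
  rw [map_sub, norm_sub_rev] at hqxz
  have hzn : a * ‖z‖ ≤ a * (‖x‖ + ‖z - x‖) :=
    mul_le_mul_of_nonneg_left (by simpa using norm_add_le x (z - x)) ha.le
  have haρ := mul_le_mul_of_nonneg_left hρx ha.le
  linarith [hqa x, hqg x r hxr, hEN _ hzE]

end

/-- Under Assumption (A) for all tilted translates of `f`, the `L`-subdifferential `∂_L f`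
is a maximal `L`-monotone operator. -/
theorem statement19 {X : Type*} [NormedAddCommGroup X] [NormedSpace ℝ X] [CompleteSpace X]
    (L : Set (X → ℝ)) (f : X → EReal)
    (hbot : ∀ x, f x ≠ ⊥) (hproper : ∃ x, f x ≠ ⊤)
    (hlsc : LowerSemicontinuous f)
    (hconv : ∃ U ⊆ L, ∀ x, f x = ⨆ u ∈ U, (u x : EReal))
    (hbar : ∀ y : X, ∀ v ∈ L,
      (∃ x, (f (x + y) - ((v (x + y) : ℝ) : EReal)) ≠ ⊤) ∧
      LowerSemicontinuous (fun x => f (x + y) - ((v (x + y) : ℝ) : EReal)) ∧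
      AssumptionA {g : X → ℝ | ∃ u ∈ L, g = fun x => u (x + y) - v (x + y) + v y - u y}
        (fun x => f (x + y) - ((v (x + y) : ℝ) : EReal))) :
    -- (i) `∂_L f` is `L`-monotone
    (∀ x y : X, ∀ u ∈ subdiff L f x, ∀ v ∈ subdiff L f y,
        0 ≤ u x - u y + v y - v x) ∧
    -- (ii) `∂_L f` is maximal `L`-monotone
    (∀ y : X, ∀ v ∈ L,
      (∀ x : X, ∀ u ∈ subdiff L f x, 0 ≤ u x - u y + v y - v x) →
        v ∈ subdiff L f y) := by
  constructor
  · intro x y u hu v hv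
    obtain ⟨w, hw⟩ := hproper
    have htop : ∀ x, ∀ l ∈ subdiff L f x, f x ≠ ⊤ := by
      intro x l hl hx
      have := hl.2 w
      rw [hx, EReal.top_add_coe] at this
      exact hw (top_le_iff.1 this)
    have h₁ := hu.2 y
    have h₂ := hv.2 x
    rw [← EReal.coe_toReal (htop x u hu) (hbot x), ← EReal.coe_toReal (htop y v hv) (hbot y)]
      at h₁ h₂
    norm_cast at h₁ h₂
    linarith
  · intro y v hv hmono
    refine ⟨hv, fun w => ?_⟩
    by_contra! hlt
    obtain ⟨-, hlsc', hA⟩ := hbar y v hv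
    have hbot' : ∀ x, f (x + y) - ((v (x + y) : ℝ) : EReal) ≠ ⊥ := by
      intro x
      rw [sub_eq_add_neg, ← EReal.coe_neg]
      simp [EReal.add_eq_bot_iff, hbot]
    have hdesc : f (w - y + y) - ((v (w - y + y) : ℝ) : EReal)
        < f (0 + y) - ((v (0 + y) : ℝ) : EReal) := by
      rw [sub_add_cancel, zero_add]
      generalize f w = F at hlt ⊢
      generalize f y = G at hlt ⊢
      induction F <;> induction G <;> simp_all [← EReal.coe_add, ← EReal.coe_sub]
      linarith
    obtain ⟨z, t, hz, _, ⟨u, hu, rfl⟩, hsub, hneg⟩ := hA.exists_subgradient_neg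
      ⟨v, hv, by funext x; ring⟩ (by rintro _ ⟨u, -, rfl⟩; simp) hbot' hlsc' hdesc
    have hfz : f (z + y) = ((t + v (z + y) : ℝ) : EReal) := by
      generalize f (z + y) = F at hz ⊢
      induction F with
      | bot => simp at hz
      | top => simp at hz
      | coe s =>
        norm_cast at hz ⊢
        linarith
    have hmem : u ∈ subdiff L f (z + y) := by
      refine ⟨hu, fun w => ?_⟩
      rw [hfz, ge_iff_le, ← EReal.coe_add, EReal.coe_le_iff_forall]
      intro r hr
      have := hsub (w - y) (r - v w) (by
        rw [sub_add_cancel, EReal.coe_sub]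
        exact EReal.sub_le_sub hr le_rfl)
      simp only [sub_add_cancel] at this
      linarith
    linarith [hmono _ u hmem]
end
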